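/- For every integer r ≥ 4 and all integers m, n with 1 < m < n, the complete graph K_r satisfies χ((K_r)^{m/n}) = ω((K_r)^{m/n}). -/

import Mathlib

open SimpleGraph

/-- Representations of vertices of the `n`-subdivision of `G`: `(u, u, 0)` represents the
branch vertex `u`, and for an adjacent pair `(u, v)`, the triple `(u, v, i)` with `i ≤ n`
represents the point at distance `i` from `u` on the path of length `n` replacing the
edge `uv`. -/
def SubdivPre {V : Type*} (G : SimpleGraph V) (n : ℕ) : Type _ :=
  {p : V × V × ℕ // (p.1 = p.2.1 ∧ p.2.2 = 0) ∨ (G.Adj p.1 p.2.1 ∧ p.2.2 ≤ n)}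

/-- The identifications between representations: `(u, v, i)` and `(v, u, n - i)` represent
the same point, and `(u, v, 0)` represents the branch vertex `u`, i.e. `(u, u, 0)`. -/
inductive SubdivRel {V : Type*} (G : SimpleGraph V) (n : ℕ) :
    SubdivPre G n → SubdivPre G n → Prop
  | flip (u v : V) (i : ℕ) (h : G.Adj u v) (hi : i ≤ n) :
      SubdivRel G n ⟨(u, v, i), Or.inr ⟨h, hi⟩⟩
        ⟨(v, u, n - i), Or.inr ⟨h.symm, Nat.sub_le n i⟩⟩
  | collapse (u v : V) (h : G.Adj u v) :
      SubdivRel G n ⟨(u, v, 0), Or.inr ⟨h, Nat.zero_le n⟩⟩ ⟨(u, u, 0), Or.inl ⟨rfl, rfl⟩⟩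

/-- The vertex set of the `n`-subdivision of `G`. -/
def SubdivVert {V : Type*} (G : SimpleGraph V) (n : ℕ) : Type _ := Quot (SubdivRel G n)

/-- The branch vertex of the subdivision corresponding to a vertex `u` of `G`. -/
def branchVertex {V : Type*} (G : SimpleGraph V) (n : ℕ) (u : V) : SubdivVert G n :=
  Quot.mk _ ⟨(u, u, 0), Or.inl ⟨rfl, rfl⟩⟩

/-- The vertex `(uv)_i` of the subdivision: the point at distance `i` from `u` on the
path of length `n` replacing the edge `uv`. -/
def mkVert {V : Type*} (G : SimpleGraph V) (n : ℕ) {u v : V} (h : G.Adj u v)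
    (i : ℕ) (hi : i ≤ n) : SubdivVert G n :=
  Quot.mk _ ⟨(u, v, i), Or.inr ⟨h, hi⟩⟩

/-- The `n`-subdivision `G^{1/n}` of `G`: each edge of `G` is replaced by a path of
length `n`; consecutive points on such a path are adjacent. -/
def subdivision {V : Type*} (G : SimpleGraph V) (n : ℕ) : SimpleGraph (SubdivVert G n) :=
  SimpleGraph.fromRel (fun x y => ∃ (u v : V) (h : G.Adj u v) (i : ℕ) (hi : i < n),
    x = mkVert G n h i (le_of_lt hi) ∧ y = mkVert G n h (i + 1) hi)

/-- The `m`-power of a graph: two distinct vertices are adjacent iff their distance is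
at most `m`, i.e. iff there is a walk of length at most `m` between them. -/
def powerGraph {W : Type*} (H : SimpleGraph W) (m : ℕ) : SimpleGraph W :=
  SimpleGraph.fromRel (fun x y => ∃ w : H.Walk x y, w.length ≤ m)

/-- The fractional power `G^{m/n}`, the `m`-power of the `n`-subdivision of `G`. -/
def fracPower {V : Type*} (G : SimpleGraph V) (m n : ℕ) : SimpleGraph (SubdivVert G n) :=
  powerGraph (subdivision G n) m


/-! ### Normal forms of points of the subdivision -/

section Infra

variable {r : ℕ}

/-- Normal form of a representation. -/
def preNF (n : ℕ) (p : Fin r × Fin r × ℕ) : Fin r × Fin r × ℕ :=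
  if p.2.2 = 0 ∨ p.1 = p.2.1 then (p.1, p.1, 0)
  else if p.2.2 = n then (p.2.1, p.2.1, 0)
  else if p.1 < p.2.1 then p else (p.2.1, p.1, n - p.2.2)

/-- Normal form of a point of the subdivision. -/
def vertNF (n : ℕ) (hn : 0 < n) :
    SubdivVert (⊤ : SimpleGraph (Fin r)) n → Fin r × Fin r × ℕ :=
  Quot.lift (fun p => preNF n p.1) (by
    intro a b h
    cases h with
    | flip u v i h hi =>
      have huv : u ≠ v := by simpa using h
      have huv' : v ≠ u := huv.symm
      simp only [preNF]
      by_cases h0 : i = 0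
      · subst h0; simp [huv', hn.ne']
      · by_cases h1 : i = n
        · subst h1; simp [huv, hn.ne']
        · have h2 : n - i ≠ 0 := by omega
          have h3 : n - i ≠ n := by omega
          have h4 : n - (n - i) = i := by omega
          rcases lt_or_gt_of_ne huv with h5 | h5
          · simp [h0, h1, h2, h3, h4, huv, huv', h5, not_lt_of_gt h5]
          · simp [h0, h1, h2, h3, h4, huv, huv', h5, not_lt_of_gt h5]
    | collapse u v h => simp [preNF])

theorem mkVert_flip {n : ℕ} {u v : Fin r} (h : (⊤ : SimpleGraph (Fin r)).Adj u v) (i : ℕ)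
    (hi : i ≤ n) : mkVert ⊤ n h i hi = mkVert ⊤ n h.symm (n - i) (Nat.sub_le n i) :=
  Quot.sound (SubdivRel.flip u v i h hi)

theorem mkVert_zero {n : ℕ} {u v : Fin r} (h : (⊤ : SimpleGraph (Fin r)).Adj u v) :
    mkVert ⊤ n h 0 (Nat.zero_le n) = branchVertex ⊤ n u :=
  Quot.sound (SubdivRel.collapse u v h)

theorem mkVert_eq {n : ℕ} (hn : 0 < n) {u v u' v' : Fin r}
    (h : (⊤ : SimpleGraph (Fin r)).Adj u v) (h' : (⊤ : SimpleGraph (Fin r)).Adj u' v')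
    (i j : ℕ) (hi : i ≤ n) (hj : j ≤ n) (he : mkVert ⊤ n h i hi = mkVert ⊤ n h' j hj) :
    (u = u' ∧ v = v' ∧ i = j) ∨ (u = v' ∧ v = u' ∧ i + j = n) ∨ (u = u' ∧ i = 0 ∧ j = 0) ∨
    (u = v' ∧ i = 0 ∧ j = n) ∨ (v = u' ∧ i = n ∧ j = 0) ∨ (v = v' ∧ i = n ∧ j = n) := by
  have huv : u ≠ v := by simpa using h
  have huv' : u' ≠ v' := by simpa using h'
  have := congrArg (vertNF n hn) he
  simp only [vertNF, mkVert, preNF, huv, huv', or_false] at this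
  split_ifs at this <;> simp only [Prod.mk.injEq] at this <;> grind

/-- Geometric description of being at distance at most `l`. -/
def Near (r n l : ℕ) (x y : SubdivVert (⊤ : SimpleGraph (Fin r)) n) : Prop :=
  (∃ (u v : Fin r) (h : (⊤ : SimpleGraph (Fin r)).Adj u v) (i j : ℕ) (hi : i ≤ n) (hj : j ≤ n),
    x = mkVert ⊤ n h i hi ∧ y = mkVert ⊤ n h j hj ∧ i ≤ j + l ∧ j ≤ i + l) ∨
  (∃ (u v w : Fin r) (h : (⊤ : SimpleGraph (Fin r)).Adj u v)
    (h' : (⊤ : SimpleGraph (Fin r)).Adj u w) (i j : ℕ) (hi : i ≤ n) (hj : j ≤ n),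
    x = mkVert ⊤ n h i hi ∧ y = mkVert ⊤ n h' j hj ∧ i + j ≤ l)

theorem exists_mk (hr : 2 ≤ r) {n : ℕ} (x : SubdivVert (⊤ : SimpleGraph (Fin r)) n) :
    ∃ (u v : Fin r) (h : (⊤ : SimpleGraph (Fin r)).Adj u v) (i : ℕ) (hi : i ≤ n),
      x = mkVert ⊤ n h i hi := by
  induction x using Quot.ind with
  | mk p =>
    obtain ⟨⟨u, v, i⟩, hp⟩ := p
    rcases hp with ⟨h1, h2⟩ | ⟨h1, h2⟩
    · simp only at h1 h2
      subst h1; subst h2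
      have : Nontrivial (Fin r) := Fin.nontrivial_iff_two_le.2 hr
      obtain ⟨w, hw⟩ := exists_ne u
      have hw' : (⊤ : SimpleGraph (Fin r)).Adj u w := by simpa using hw.symm
      exact ⟨u, w, hw', 0, Nat.zero_le n, (mkVert_zero hw').symm⟩
    · exact ⟨u, v, h1, i, h2, rfl⟩

theorem adj_exists {n : ℕ} {x y : SubdivVert (⊤ : SimpleGraph (Fin r)) n}
    (h : (subdivision ⊤ n).Adj x y) :
    ∃ (u v : Fin r) (h : (⊤ : SimpleGraph (Fin r)).Adj u v) (i : ℕ) (hi : i < n),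
    x = mkVert ⊤ n h i (le_of_lt hi) ∧ y = mkVert ⊤ n h (i + 1) hi := by
  simp only [subdivision, SimpleGraph.fromRel_adj] at h
  rcases h.2 with h | ⟨u, v, h, i, hi, hx, hy⟩
  · exact h
  · refine ⟨v, u, h.symm, n - (i + 1), by omega, ?_, ?_⟩
    · rw [hy, mkVert_flip]
    · rw [hx, mkVert_flip]; congr 1; omega

theorem near_step {n l : ℕ} (hl : l < n) {x y z : SubdivVert (⊤ : SimpleGraph (Fin r)) n}
    (h : Near r n l x y) (hyz : (subdivision ⊤ n).Adj y z) : Near r n (l + 1) x z := by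
  obtain ⟨a, b, hab, p, hp, rfl, rfl⟩ := adj_exists hyz
  have hn : 0 < n := by omega
  rcases h with ⟨u, v, h, i, j, hi, hj, rfl, hy, h1, h2⟩ | ⟨u, v, w, h, h', i, j, hi, hj, rfl, hy, h1⟩
  · rcases mkVert_eq hn _ _ _ _ _ _ hy with ⟨rfl, rfl, rfl⟩ | ⟨rfl, rfl, h3⟩ | ⟨rfl, rfl, rfl⟩ |
      ⟨rfl, rfl, rfl⟩ | ⟨rfl, rfl, rfl⟩ | ⟨rfl, rfl, rfl⟩
    · exact Or.inl ⟨_, _, hab, i, p + 1, hi, hp, rfl, rfl, by omega, by omega⟩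
    · refine Or.inl ⟨_, _, hab.symm, i, n - (p + 1), hi, by omega, rfl, mkVert_flip _ _ _,
        by omega, by omega⟩
    · exact Or.inr ⟨_, _, _, h, hab, i, 1, hi, by omega, rfl, rfl, by omega⟩
    · exact Or.inr ⟨_, _, _, h.symm, hab, j - i, 1, by omega, by omega, mkVert_flip _ _ _, rfl,
        by omega⟩
    · omega
    · omega
  · rcases mkVert_eq hn _ _ _ _ _ _ hy with ⟨rfl, rfl, rfl⟩ | ⟨rfl, rfl, h3⟩ | ⟨rfl, rfl, rfl⟩ |
      ⟨rfl, rfl, rfl⟩ | ⟨rfl, rfl, rfl⟩ | ⟨rfl, rfl, rfl⟩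
    · exact Or.inr ⟨_, _, _, h, hab, i, p + 1, hi, hp, rfl, rfl, by omega⟩
    · exact Or.inr ⟨_, _, _, h, h', i, n - (p + 1), hi, by omega, rfl, mkVert_flip _ _ _,
        by omega⟩
    · exact Or.inr ⟨_, _, _, h, hab, i, 1, hi, by omega, rfl, rfl, by omega⟩
    · omega
    · omega
    · omega

theorem near_mono {n l l' : ℕ} (hl : l ≤ l') {x y : SubdivVert (⊤ : SimpleGraph (Fin r)) n}
    (h : Near r n l x y) : Near r n l' x y := by
  rcases h with ⟨u, v, h, i, j, hi, hj, rfl, hy, h1, h2⟩ | ⟨u, v, w, h, h', i, j, hi, hj, rfl, hy, h1⟩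
  · exact Or.inl ⟨u, v, h, i, j, hi, hj, rfl, hy, by omega, by omega⟩
  · exact Or.inr ⟨u, v, w, h, h', i, j, hi, hj, rfl, hy, by omega⟩

theorem near_of_walk (hr : 2 ≤ r) {n : ℕ} {x y : SubdivVert (⊤ : SimpleGraph (Fin r)) n}
    (l : ℕ) (hl : l < n) (w : (subdivision ⊤ n).Walk x y) (hw : w.length = l) :
    Near r n l x y := by
  induction l generalizing y with
  | zero =>
    have := SimpleGraph.Walk.eq_of_length_eq_zero hw
    subst this
    obtain ⟨u, v, h, i, hi, rfl⟩ := exists_mk hr x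
    exact Or.inl ⟨u, v, h, i, i, hi, hi, rfl, rfl, by omega, by omega⟩
  | succ l ih =>
    obtain ⟨z, w', hz, hw'⟩ : ∃ z, ∃ w' : (subdivision ⊤ n).Walk x z,
        (subdivision ⊤ n).Adj z y ∧ w'.length = l := by
      have hnil : ¬ w.Nil := by
        rw [← SimpleGraph.Walk.length_eq_zero_iff]; omega
      refine ⟨w.penultimate, w.dropLast, w.adj_penultimate hnil, ?_⟩
      have := w.length_dropLast_add_one hnil
      omega
    exact near_step (by omega) (ih (by omega) w' hw') hz

/-- Existence of a suitable coloured path for the edge `uv`. -/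
def EdgeOK (r m n : ℕ) (S : Finset (ℕ × ℕ)) (b : ℕ → ℕ → ℕ → ℕ × ℕ) (u v : ℕ) : Prop :=
  ∃ e : ℕ → ℕ × ℕ, (∀ p ≤ n, e p ∈ S) ∧ (∀ p ≤ m / 2, e p = b u v p) ∧
    (∀ p ≤ m / 2, e (n - p) = b v u p) ∧
    (∀ p q, p < q → q ≤ n → q ≤ p + m → e p ≠ e q) ∧
    (∀ w < r, w ≠ u → w ≠ v → ∀ j p, 1 ≤ j → j ≤ m / 2 → 1 ≤ p → j + p ≤ m → e p ≠ b u w j) ∧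
    (∀ w < r, w ≠ u → w ≠ v → ∀ j p, 1 ≤ j → j ≤ m / 2 → 1 ≤ p → j + p ≤ m →
      e (n - p) ≠ b v w j)

/-- Existence of compatible colourings of all balls and edges. -/
def Good (r m n : ℕ) : Prop :=
  ∃ (S : Finset (ℕ × ℕ)) (b : ℕ → ℕ → ℕ → ℕ × ℕ),
    S.card ≤ (m / 2) * (r - 1) + 1 + m % 2 ∧ (∀ u v w, b u v 0 = b u w 0) ∧
    ∀ u v, u < v → v < r → EdgeOK r m n S b u v

theorem Good.ext {r m n : ℕ} (hmn : m < n) (h : Good r m n) : Good r m (n + (m + 1)) := by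
  obtain ⟨S, b, hS, hb, h⟩ := h
  refine ⟨S, b, hS, hb, fun u v huv hv => ?_⟩
  obtain ⟨e, h1, h2, h3, h4, h5, h6⟩ := h u v huv hv
  have key : ∀ p, p ≤ m → (if n + (m + 1) - p ≤ m then e (n + (m + 1) - p)
      else e (n + (m + 1) - p - (m + 1))) = e (n - p) := by
    intro p hp
    rw [if_neg (by omega)]
    congr 1; omega
  refine ⟨fun p => if p ≤ m then e p else e (p - (m + 1)), ?_, ?_, ?_, ?_, ?_, ?_⟩
  · intro p hp
    dsimp only
    split_ifs
    · exact h1 _ (by omega)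
    · exact h1 _ (by omega)
  · intro p hp
    dsimp only
    rw [if_pos (by omega)]; exact h2 p hp
  · intro p hp
    dsimp only
    rw [key p (by omega)]; exact h3 p hp
  · intro p q hpq hq hqm
    dsimp only
    split_ifs
    · exact h4 _ _ hpq (by omega) hqm
    · exact (h4 _ _ (by omega) (by omega) (by omega)).symm
    · omega
    · exact h4 _ _ (by omega) (by omega) (by omega)
  · intro w hw hwu hwv j p hj hj' hp hjp
    dsimp only
    rw [if_pos (by omega)]; exact h5 w hw hwu hwv j p hj hj' hp hjp
  · intro w hw hwu hwv j p hj hj' hp hjp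
    dsimp only
    rw [key p (by omega)]; exact h6 w hw hwu hwv j p hj hj' hp hjp

/-- A symmetric system of edge colourings yields a proper colouring. -/
theorem colorable_of_sym {m n : ℕ} (hr : 2 ≤ r) (hmn : m < n) (S : Finset (ℕ × ℕ))
    (z : Fin r → ℕ × ℕ) (c : Fin r → Fin r → ℕ → ℕ × ℕ) 
    (hc : ∀ u v, u ≠ v → ∀ p ≤ n, c u v p ∈ S)
    (hsym : ∀ u v, u ≠ v → ∀ p ≤ n, c u v p = c v u (n - p))
    (h0 : ∀ u v, u ≠ v → c u v 0 = z u)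
    (hwin : ∀ u v, u ≠ v → ∀ p q, p < q → q ≤ n → q ≤ p + m → c u v p ≠ c u v q)
    (hball : ∀ u v w, u ≠ v → u ≠ w → v ≠ w → ∀ p q, 1 ≤ p → 1 ≤ q → p + q ≤ m →
      c u v p ≠ c u w q) :
    (fracPower (⊤ : SimpleGraph (Fin r)) m n).Colorable S.card := by
  classical
  let F : SubdivVert (⊤ : SimpleGraph (Fin r)) n → ℕ × ℕ :=
    Quot.lift (fun p => if p.1.1 = p.1.2.1 then z p.1.1 else c p.1.1 p.1.2.1 p.1.2.2) (by
      intro a b h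
      cases h with
      | flip u v i h hi =>
        have huv : u ≠ v := by simpa using h
        simp only [if_neg huv, if_neg huv.symm]
        exact hsym u v huv i hi
      | collapse u v h =>
        have huv : u ≠ v := by simpa using h
        simp only [if_neg huv, if_true]
        exact h0 u v huv)
  have hF : ∀ (u v : Fin r) (h : (⊤ : SimpleGraph (Fin r)).Adj u v) (i : ℕ) (hi : i ≤ n),
      F (mkVert ⊤ n h i hi) = c u v i := by
    intro u v h i hi
    have huv : u ≠ v := by simpa using h
    simp only [F, mkVert, if_neg huv]
  have hS : ∀ x, F x ∈ S := by
    intro x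
    obtain ⟨u, v, h, i, hi, rfl⟩ := exists_mk hr x
    rw [hF]
    exact hc u v (by simpa using h) i hi
  have hne : ∀ x y, x ≠ y → Near r n m x y → F x ≠ F y := by
    intro x y hxy h
    have same : ∀ (u v : Fin r) (h : (⊤ : SimpleGraph (Fin r)).Adj u v) (i j : ℕ) (hi : i ≤ n)
        (hj : j ≤ n), x = mkVert ⊤ n h i hi → y = mkVert ⊤ n h j hj → i ≤ j + m → j ≤ i + m →
        F x ≠ F y := by
      intro u v h i j hi hj hx hy h1 h2
      have huv : u ≠ v := by simpa using h
      subst hx; subst hy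
      rw [hF, hF]
      rcases lt_trichotomy i j with h3 | h3 | h3
      · exact hwin u v huv i j h3 hj h2
      · subst h3; exact absurd rfl hxy
      · exact (hwin u v huv j i h3 hi h1).symm
    rcases h with ⟨u, v, h, i, j, hi, hj, hx, hy, h1, h2⟩ | ⟨u, v, w, h, h', i, j, hi, hj, hx, hy, h1⟩
    · exact same u v h i j hi hj hx hy h1 h2
    · by_cases hvw : v = w
      · subst hvw
        exact same u v h i j hi hj hx hy (by omega) (by omega)
      · rcases Nat.eq_zero_or_pos i with hi0 | hi0
        · subst hi0
          exact same u w h' 0 j (by omega) hj (by rw [hx, mkVert_zero, mkVert_zero]) hy (by omega)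
            (by omega)
        · rcases Nat.eq_zero_or_pos j with hj0 | hj0
          · subst hj0
            exact same u v h i 0 hi (by omega) hx (by rw [hy, mkVert_zero, mkVert_zero]) (by omega)
              (by omega)
          · rw [hx, hy, hF, hF]
            exact hball u v w (by simpa using h) (by simpa using h') hvw i j hi0 hj0 h1
  have C : (fracPower (⊤ : SimpleGraph (Fin r)) m n).Coloring S :=
    SimpleGraph.Coloring.mk (fun x => ⟨F x, hS x⟩) (by
      intro x y hxy heq
      simp only [fracPower, powerGraph, SimpleGraph.fromRel_adj] at hxy
      have heq' : F x = F y := congrArg Subtype.val heq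
      rcases hxy.2 with ⟨w, hw⟩ | ⟨w, hw⟩
      · exact hne x y hxy.1 (near_mono hw (near_of_walk hr _ (by omega) w rfl)) heq'
      · exact hne y x hxy.1.symm (near_mono hw (near_of_walk hr _ (by omega) w rfl)) heq'.symm)
  have := C.colorable
  simpa using this

theorem Good.colorable {m n : ℕ} (hr : 2 ≤ r) (hmn : m < n) (h : Good r m n) :
    (fracPower (⊤ : SimpleGraph (Fin r)) m n).Colorable ((m / 2) * (r - 1) + 1 + m % 2) := by
  obtain ⟨S, b, hS, hb, h⟩ := h
  choose! e h1 h2 h3 h4 h5 h6 using h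
  refine SimpleGraph.Colorable.mono hS ?_
  have h2' : ∀ u v, u < v → v < r → e u v 0 = b u v 0 := fun u v huv hv =>
    h2 u v huv hv 0 (by omega)
  have h3' : ∀ u v, u < v → v < r → e u v n = b v u 0 := fun u v huv hv =>
    h3 u v huv hv 0 (by omega)
  let c : Fin r → Fin r → ℕ → ℕ × ℕ := fun u v p =>
    if u < v then e u v p else e v u (n - p)
  have hcl : ∀ u v : Fin r, u < v → ∀ p, c u v p = e u v p := fun u v huv p => by
    simp only [c, if_pos huv]
  have hcg : ∀ u v : Fin r, v < u → ∀ p, c u v p = e v u (n - p) := fun u v huv p => by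
    simp only [c, if_neg (not_lt_of_gt huv)]
  have hcb : ∀ u v : Fin r, u ≠ v → ∀ p ≤ m / 2, c u v p = b u v p := by
    intro u v huv p hp
    rcases lt_or_gt_of_ne huv with h | h
    · rw [hcl u v h]; exact h2 u v h v.2 p hp
    · rw [hcg u v h]; exact h3 v u h u.2 p hp
  have hcd : ∀ u v w : Fin r, u ≠ v → u ≠ w → v ≠ w → ∀ p j, 1 ≤ p → 1 ≤ j → j ≤ m / 2 →
      j + p ≤ m → c u v p ≠ b u w j := by
    intro u v w huv huw hvw p j hp hj hj' hjp
    have a1 : (w : ℕ) ≠ u := fun hh => huw (Fin.ext hh.symm)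
    have a2 : (w : ℕ) ≠ v := fun hh => hvw (Fin.ext hh.symm)
    rcases lt_or_gt_of_ne huv with h | h
    · rw [hcl u v h]; exact h5 u v h v.2 w w.2 a1 a2 j p hj hj' hp hjp
    · rw [hcg u v h]; exact h6 v u h u.2 w w.2 a2 a1 j p hj hj' hp hjp
  refine colorable_of_sym hr hmn S (fun u => b u u 0) c ?_ ?_ ?_ ?_ ?_
  · intro u v huv p hp
    rcases lt_or_gt_of_ne huv with h | h
    · rw [hcl u v h]; exact h1 u v h v.2 _ hp
    · rw [hcg u v h]; exact h1 v u h u.2 _ (by omega)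
  · intro u v huv p hp
    rcases lt_or_gt_of_ne huv with h | h
    · rw [hcl u v h, hcg v u h]; congr 1; omega
    · rw [hcg u v h, hcl v u h]
  · intro u v huv
    rw [hcb u v huv 0 (by omega)]; exact hb u v u
  · intro u v huv p q hpq hq hqm
    rcases lt_or_gt_of_ne huv with h | h
    · rw [hcl u v h, hcl u v h]; exact h4 u v h v.2 p q hpq hq hqm
    · rw [hcg u v h, hcg u v h]
      exact (h4 v u h u.2 (n - q) (n - p) (by omega) (by omega) (by omega)).symm
  · intro u v w huv huw hvw p q hp hq hpq
    by_cases hq' : q ≤ m / 2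
    · rw [hcb u w huw q hq']
      exact hcd u v w huv huw hvw p q hp hq hq' (by omega)
    · rw [hcb u v huv p (by omega)]
      exact (hcd u w v huw huv hvw.symm q p hq hp (by omega) (by omega)).symm

end Infra

section Clique

variable {r : ℕ}

theorem adj_succ {n : ℕ} {u v : Fin r} (h : (⊤ : SimpleGraph (Fin r)).Adj u v) (i : ℕ)
    (hi : i < n) (hn : 1 < n) :
    (subdivision ⊤ n).Adj (mkVert ⊤ n h i (le_of_lt hi)) (mkVert ⊤ n h (i + 1) hi) := by
  have huv : u ≠ v := by simpa using h
  simp only [subdivision, SimpleGraph.fromRel_adj]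
  refine ⟨fun he => ?_, Or.inl ⟨u, v, h, i, hi, rfl, rfl⟩⟩
  rcases mkVert_eq (by omega) _ _ _ _ _ _ he with h | h | h | h | h | h
  · omega
  · exact huv h.1
  · omega
  · exact huv h.1
  · omega
  · omega

theorem walk_to_branch {n : ℕ} {u v : Fin r} (h : (⊤ : SimpleGraph (Fin r)).Adj u v)
    (hn : 1 < n) (i : ℕ) (hi : i ≤ n) :
    ∃ w : (subdivision ⊤ n).Walk (branchVertex ⊤ n u) (mkVert ⊤ n h i hi), w.length = i := by
  induction i with
  | zero =>
    rw [mkVert_zero]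
    exact ⟨SimpleGraph.Walk.nil, rfl⟩
  | succ i ih =>
    obtain ⟨w, hw⟩ := ih (by omega)
    exact ⟨w.concat (adj_succ h i hi hn), by simp [hw]⟩

theorem exists_clique {m n : ℕ} (hm : 1 < m) (hmn : m < n) :
    ∃ s, (fracPower (⊤ : SimpleGraph (Fin (r + 2))) m n).IsNClique
      ((m / 2) * (r + 1) + 1 + m % 2) s := by
  classical
  have hadj : ∀ v : Fin (r + 1), (⊤ : SimpleGraph (Fin (r + 2))).Adj 0 v.succ := by
    intro v
    simpa using (Fin.succ_ne_zero v).symm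
  let G : Fin (r + 1) × ℕ → SubdivVert (⊤ : SimpleGraph (Fin (r + 2))) n := fun x =>
    if hi : x.2 ≤ n then mkVert ⊤ n (hadj x.1) x.2 hi else branchVertex ⊤ n 0
  let I1 : Finset (Fin (r + 1) × ℕ) := Finset.univ ×ˢ Finset.Icc 1 (m / 2)
  let I2 : Finset (Fin (r + 1) × ℕ) := {(0, 0)}
  let I3 : Finset (Fin (r + 1) × ℕ) := if m % 2 = 1 then {(0, m / 2 + 1)} else ∅
  let I : Finset (Fin (r + 1) × ℕ) := (I1 ∪ I2) ∪ I3
  have hI : ∀ x ∈ I, (x.2 = 0 → x.1 = 0) ∧ x.2 ≤ n ∧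
      (x.2 ≤ m / 2 ∨ (m % 2 = 1 ∧ x = (0, m / 2 + 1))) := by
    intro x hx
    obtain ⟨v, i⟩ := x
    simp only [I, I1, I2, I3, Finset.mem_union, Finset.mem_product, Finset.mem_univ, true_and,
      Finset.mem_Icc, Finset.mem_singleton] at hx
    rcases hx with (hx | hx) | hx
    · refine ⟨fun h => ?_, ?_, Or.inl hx.2⟩
      · simp only at h; omega
      · show i ≤ n
        omega
    · simp only [Prod.mk.injEq] at hx
      obtain ⟨rfl, rfl⟩ := hx
      simp
    · split_ifs at hx with h
      · simp only [Finset.mem_singleton, Prod.mk.injEq] at hx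
        obtain ⟨rfl, rfl⟩ := hx
        refine ⟨fun _ => rfl, ?_, Or.inr ⟨h, rfl⟩⟩
        show m / 2 + 1 ≤ n
        omega
      · simp at hx
  have hcard : I.card = (m / 2) * (r + 1) + 1 + m % 2 := by
    have d1 : Disjoint I1 I2 := by
      simp [I1, I2]
    have d2 : Disjoint (I1 ∪ I2) I3 := by
      by_cases h : m % 2 = 1 <;> simp [I1, I2, I3, h]
    rw [Finset.card_union_of_disjoint d2, Finset.card_union_of_disjoint d1]
    have : I3.card = m % 2 := by
      by_cases h : m % 2 = 1
      · simp [I3, h]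
      · simp only [I3, h, if_false, Finset.card_empty]; omega
    rw [this]
    simp [I1, I2, Finset.card_product, mul_comm]
  have hinj : Set.InjOn G I := by
    intro x hx y hy hxy
    obtain ⟨hx1, hx2, -⟩ := hI x hx
    obtain ⟨hy1, hy2, -⟩ := hI y hy
    obtain ⟨v, i⟩ := x
    obtain ⟨w, j⟩ := y
    simp only [G] at hxy
    simp only at hx1 hx2 hy1 hy2
    rw [dif_pos hx2, dif_pos hy2] at hxy
    rcases mkVert_eq (by omega) _ _ _ _ _ _ hxy with h | h | h | h | h | h
    · have := Fin.succ_injective _ h.2.1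
      simp [this, h.2.2]
    · exact absurd h.1.symm (Fin.succ_ne_zero w)
    · simp [hx1 h.2.1, hy1 h.2.2, h.2.1, h.2.2]
    · exact absurd h.1.symm (Fin.succ_ne_zero w)
    · exact absurd h.1 (Fin.succ_ne_zero v)
    · have := Fin.succ_injective _ h.1
      simp [this, h.2]
  refine ⟨I.image G, ?_, ?_⟩
  · intro a ha b hb hab
    simp only [Finset.coe_image, Set.mem_image, Finset.mem_coe] at ha hb
    obtain ⟨x, hx, rfl⟩ := ha
    obtain ⟨y, hy, rfl⟩ := hb
    have hxy : x ≠ y := fun h => hab (by rw [h])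
    obtain ⟨-, hx2, hx3⟩ := hI x hx
    obtain ⟨-, hy2, hy3⟩ := hI y hy
    simp only [fracPower, powerGraph, SimpleGraph.fromRel_adj]
    refine ⟨hab, Or.inl ?_⟩
    obtain ⟨w1, hw1⟩ := walk_to_branch (hadj x.1) (show 1 < n by omega) x.2 hx2
    obtain ⟨w2, hw2⟩ := walk_to_branch (hadj y.1) (show 1 < n by omega) y.2 hy2
    have e1 : G x = mkVert ⊤ n (hadj x.1) x.2 hx2 := by simp only [G]; rw [dif_pos hx2]
    have e2 : G y = mkVert ⊤ n (hadj y.1) y.2 hy2 := by simp only [G]; rw [dif_pos hy2]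
    rw [e1, e2]
    refine ⟨w1.reverse.append w2, ?_⟩
    simp only [SimpleGraph.Walk.length_append, SimpleGraph.Walk.length_reverse, hw1, hw2]
    rcases hx3 with hx3 | hx3 <;> rcases hy3 with hy3 | hy3
    · omega
    · have := congrArg Prod.snd hy3.2
      simp only at this
      omega
    · have := congrArg Prod.snd hx3.2
      simp only at this
      omega
    · exact absurd (hx3.2.trans hy3.2.symm) hxy
  · rw [Finset.card_image_of_injOn hinj, hcard]

theorem main_of_good (hr : 2 ≤ r) {m n : ℕ} (hm : 1 < m) (hmn : m < n) (h : Good r m n) :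
    (fracPower (⊤ : SimpleGraph (Fin r)) m n).chromaticNumber =
      (fracPower (⊤ : SimpleGraph (Fin r)) m n).cliqueNum := by
  obtain ⟨r, rfl⟩ : ∃ r', r = r' + 2 := ⟨r - 2, by omega⟩
  have hcol := h.colorable hr hmn
  obtain ⟨s, hs⟩ := exists_clique (r := r) hm hmn
  have e : r + 2 - 1 = r + 1 := by omega
  rw [e] at hcol
  set N := (m / 2) * (r + 1) + 1 + m % 2 with hN
  have hbound : ∀ (t : Finset (SubdivVert (⊤ : SimpleGraph (Fin (r + 2))) n)) (j : ℕ),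
      (fracPower (⊤ : SimpleGraph (Fin (r + 2))) m n).IsNClique j t → j ≤ N := by
    intro t j ht
    have := ht.1.card_le_of_colorable hcol
    rw [← ht.2]; exact this
  have hcl : (fracPower (⊤ : SimpleGraph (Fin (r + 2))) m n).cliqueNum = N := by
    apply le_antisymm
    · exact csSup_le ⟨N, s, hs⟩ (fun j ⟨t, ht⟩ => hbound t j ht)
    · exact le_csSup ⟨N, fun j ⟨t, ht⟩ => hbound t j ht⟩ ⟨s, hs⟩
  rw [hcl]
  apply le_antisymm
  · exact hcol.chromaticNumber_le
  · have := hs.1.card_le_chromaticNumber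
    rw [hs.2] at this
    exact this

end Clique

section Build

/-- Assemble a coloured edge from the two balls at its ends and a middle part. -/
theorem edge_build {r m n k : ℕ} {S : Finset (ℕ × ℕ)} {b : ℕ → ℕ → ℕ → ℕ × ℕ} {u v : ℕ}
    (hk : m / 2 = k) (hmn : m < n) (mid : ℕ → ℕ × ℕ)
    (s1 : ∀ p ≤ k, b u v p ∈ S ∧ b v u p ∈ S) (s2 : ∀ p, k < p → p + k < n → mid p ∈ S)
    (w1 : ∀ p q, p < q → q ≤ k → b u v p ≠ b u v q ∧ b v u p ≠ b v u q)
    (w2 : ∀ p q, p ≤ k → q ≤ k → n ≤ p + q + m → b u v p ≠ b v u q)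
    (w3 : ∀ p q, p ≤ k → k < q → q + k < n → q ≤ p + m → mid q ≠ b u v p)
    (w3' : ∀ p q, p ≤ k → k < q → q + k < n → n ≤ q + p + m → mid q ≠ b v u p)
    (w4 : ∀ p q, p < q → k < p → q + k < n → q ≤ p + m → mid p ≠ mid q)
    (d1 : ∀ w < r, w ≠ u → w ≠ v → ∀ p j, 1 ≤ j → j ≤ k → 1 ≤ p → p ≤ k →
      b u v p ≠ b u w j ∧ b v u p ≠ b v w j)
    (d2 : ∀ w < r, w ≠ u → w ≠ v → ∀ q j, 1 ≤ j → j ≤ k → q ≤ k → n + j ≤ q + m →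
      b v u q ≠ b u w j ∧ b u v q ≠ b v w j)
    (d3 : ∀ w < r, w ≠ u → w ≠ v → ∀ p j, 1 ≤ j → j ≤ k → k < p → p + k < n → j + p ≤ m →
      mid p ≠ b u w j)
    (d3' : ∀ w < r, w ≠ u → w ≠ v → ∀ p j, 1 ≤ j → j ≤ k → k < p → p + k < n → n + j ≤ p + m →
      mid p ≠ b v w j) :
    EdgeOK r m n S b u v := by
  subst hk
  have hcase : ∀ p ≤ n, p ≤ m / 2 ∨ (m / 2 < p ∧ p + m / 2 < n) ∨ (m / 2 < p ∧ n ≤ p + m / 2) := by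
    intro p hp; omega
  let e : ℕ → ℕ × ℕ := fun p =>
    if p ≤ m / 2 then b u v p else if p + m / 2 < n then mid p else b v u (n - p)
  have e1 : ∀ p, p ≤ m / 2 → e p = b u v p := fun p hp => if_pos hp
  have e2 : ∀ p, m / 2 < p → p + m / 2 < n → e p = mid p := fun p hp hp' => by
    simp only [e]; rw [if_neg (by omega), if_pos hp']
  have e3 : ∀ p, m / 2 < p → n ≤ p + m / 2 → e p = b v u (n - p) := fun p hp hp' => by
    simp only [e]; rw [if_neg (by omega), if_neg (by omega)]
  refine ⟨e, ?_, e1, ?_, ?_, ?_, ?_⟩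
  · intro p hp
    rcases hcase p hp with h | h | h
    · rw [e1 p h]; exact (s1 p h).1
    · rw [e2 p h.1 h.2]; exact s2 p h.1 h.2
    · rw [e3 p h.1 h.2]; exact (s1 _ (by omega)).2
  · intro p hp
    rw [e3 _ (by omega) (by omega)]; congr 1; omega
  · intro p q hpq hq hqm
    rcases hcase p (by omega) with h | h | h <;> rcases hcase q hq with h' | h' | h'
    · rw [e1 p h, e1 q h']; exact (w1 p q hpq h').1
    · rw [e1 p h, e2 q h'.1 h'.2]; exact (w3 p q h h'.1 h'.2 hqm).symm
    · rw [e1 p h, e3 q h'.1 h'.2]; exact w2 p _ h (by omega) (by omega)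
    · omega
    · rw [e2 p h.1 h.2, e2 q h'.1 h'.2]; exact w4 p q hpq h.1 h'.2 hqm
    · rw [e2 p h.1 h.2, e3 q h'.1 h'.2]; exact w3' _ p (by omega) h.1 h.2 (by omega)
    · omega
    · omega
    · rw [e3 p h.1 h.2, e3 q h'.1 h'.2]; exact (w1 (n - q) (n - p) (by omega) (by omega)).2.symm
  · intro w hw hwu hwv j p hj hj' hp hjp
    rcases hcase p (by omega) with h | h | h
    · rw [e1 p h]; exact (d1 w hw hwu hwv p j hj hj' hp h).1
    · rw [e2 p h.1 h.2]; exact d3 w hw hwu hwv p j hj hj' h.1 h.2 hjp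
    · rw [e3 p h.1 h.2]; exact (d2 w hw hwu hwv _ j hj hj' (by omega) (by omega)).1
  · intro w hw hwu hwv j p hj hj' hp hjp
    rcases hcase (n - p) (by omega) with h | h | h
    · rw [e1 _ h]; exact (d2 w hw hwu hwv _ j hj hj' h (by omega)).2
    · rw [e2 _ h.1 h.2]; exact d3' w hw hwu hwv _ j hj hj' h.1 h.2 (by omega)
    · rw [e3 _ h.1 h.2]; exact (d1 w hw hwu hwv _ j hj hj' (by omega) (by omega)).2

/-- Half-edge labels with `r - 1` labels, distinct around each vertex and different at the two
ends of each edge. -/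
theorem exists_labels (r : ℕ) (hr : 4 ≤ r) : ∃ s : ℕ → ℕ → ℕ,
    (∀ u v, u < r → v < r → u ≠ v → s u v < r - 1) ∧
    (∀ u v w, u < r → v < r → w < r → u ≠ v → u ≠ w → v ≠ w → s u v ≠ s u w) ∧
    (∀ u v, u < r → v < r → u ≠ v → s u v ≠ s v u) := by
  refine ⟨fun u v => (if u < v then (if 2 * (v - u) = r then 1
    else if v - u = 1 ∧ 2 * u < r ∧ r % 2 = 0 then r / 2 else v - u) else r - (u - v)) - 1,
    ?_, ?_, ?_⟩
  · intro u v hu hv huv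
    dsimp only
    split_ifs <;> omega
  · intro u v w hu hv hw huv huw hvw
    dsimp only
    split_ifs <;> omega
  · intro u v hu hv huv
    dsimp only
    split_ifs <;> omega

theorem exists_derangements (r : ℕ) (hr : 4 ≤ r) : ∃ f : ℕ → ℕ → ℕ,
    (∀ u v, u < r → v < r → u ≠ v → f u v < r ∧ f u v ≠ u ∧ f u v ≠ v) ∧
    (∀ u v w, u < r → v < r → w < r → u ≠ v → u ≠ w → v ≠ w → f u v ≠ f u w) ∧
    (∀ u v, u < r → v < r → u ≠ v → f u v ≠ f v u) := by
  induction r, hr using Nat.le_induction with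
  | base =>
    let g : Fin 4 → Fin 4 → Fin 4 := ![![0, 2, 3, 1], ![3, 0, 0, 2], ![1, 3, 0, 0], ![2, 0, 1, 0]]
    have h1 : ∀ u v : Fin 4, u ≠ v → g u v ≠ u ∧ g u v ≠ v := by decide
    have h2 : ∀ u v w : Fin 4, u ≠ v → u ≠ w → v ≠ w → g u v ≠ g u w := by decide
    have h3 : ∀ u v : Fin 4, u ≠ v → g u v ≠ g v u := by decide
    refine ⟨fun u v => if h : u < 4 ∧ v < 4 then (g ⟨u, h.1⟩ ⟨v, h.2⟩ : ℕ) else 0, ?_, ?_, ?_⟩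
    · intro u v hu hv huv
      dsimp only
      rw [dif_pos ⟨hu, hv⟩]
      have := h1 ⟨u, hu⟩ ⟨v, hv⟩ (by simpa using huv)
      refine ⟨Fin.is_lt _, fun h => this.1 (Fin.ext h), fun h => this.2 (Fin.ext h)⟩
    · intro u v w hu hv hw huv huw hvw
      dsimp only
      rw [dif_pos ⟨hu, hv⟩, dif_pos ⟨hu, hw⟩]
      have := h2 ⟨u, hu⟩ ⟨v, hv⟩ ⟨w, hw⟩ (by simpa using huv) (by simpa using huw) (by simpa using hvw)
      exact fun h => this (Fin.ext h)
    · intro u v hu hv huv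
      dsimp only
      rw [dif_pos ⟨hu, hv⟩, dif_pos ⟨hv, hu⟩]
      have := h3 ⟨u, hu⟩ ⟨v, hv⟩ (by simpa using huv)
      exact fun h => this (Fin.ext h)
  | succ r hr ih =>
    obtain ⟨f, h1, h2, h3⟩ := ih
    obtain ⟨p, hp⟩ : ∃ p : ℕ → ℕ, ∀ u, p u = if u + 1 = r then 0 else u + 1 := ⟨_, fun _ => rfl⟩
    have p1 : ∀ u < r, p u < r ∧ p u ≠ u := by
      intro u hu; rw [hp]; split_ifs <;> omega
    have p2 : ∀ u < r, ∀ v < r, p u = p v → u = v := by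
      intro u hu v hv q1
      rw [hp, hp] at q1
      split_ifs at q1 <;> omega
    have p3 : ∀ u < r, ∀ v < r, p u = v → p v = u → False := by
      intro u hu v hv q1 q2
      rw [hp] at q1 q2
      split_ifs at q1 q2 <;> omega
    refine ⟨fun u v => if u = r then p v else if v = r then f u (p u) else
      if v = p u then r else f u v, ?_, ?_, ?_⟩
    · intro u v hu hv huv
      dsimp only
      split_ifs with a1 a2 a3
      · have := p1 v (by omega); omega
      · have := p1 u (by omega); have := h1 u (p u) (by omega) (by omega) (by omega); omega
      · omega
      · have := h1 u v (by omega) (by omega) huv; omega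
    · intro u v w hu hv hw huv huw hvw
      dsimp only
      by_cases hur : u = r
      · simp only [hur, if_true]
        intro h
        exact hvw (p2 v (by omega) w (by omega) h)
      · have q := p1 u (by omega)
        have q1 := h1 u (p u) (by omega) (by omega) (by omega)
        simp only [hur, if_false]
        by_cases hvr : v = r
        · have hwr : w ≠ r := by omega
          simp only [hvr, hwr, if_true, if_false]
          split_ifs with a
          · omega
          · exact h2 u (p u) w (by omega) (by omega) (by omega) (by omega) huw (by omega)
        · have q2 := h1 u v (by omega) (by omega) huv
          simp only [hvr, if_false]
          by_cases hwr : w = r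
          · simp only [hwr, if_true]
            split_ifs with a
            · omega
            · exact h2 u v (p u) (by omega) (by omega) (by omega) huv (by omega) (by omega)
          · have q3 := h1 u w (by omega) (by omega) huw
            simp only [hwr, if_false]
            split_ifs with a a' a'
            · omega
            · omega
            · omega
            · exact h2 u v w (by omega) (by omega) (by omega) huv huw hvw
    · intro u v hu hv huv
      dsimp only
      have := p1 u
      have := p1 v
      have := p3 u
      have := h1 u (p u)
      have := h1 v (p v)
      have := h1 u v
      have := h1 v u
      have := h3 u v
      split_ifs <;> grind

/-- Colours for even powers. -/
def SE (r k : ℕ) : Finset (ℕ × ℕ) := insert (0, 0) (Finset.range (r - 1) ×ˢ Finset.Icc 1 k)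

theorem SE_card (r k : ℕ) : (SE r k).card ≤ k * (r - 1) + 1 := by
  refine (Finset.card_insert_le _ _).trans ?_
  simp [Finset.card_product, mul_comm]

theorem mem_SE {r k c i : ℕ} : (c, i) ∈ SE r k ↔ (c = 0 ∧ i = 0) ∨ (c < r - 1 ∧ 1 ≤ i ∧ i ≤ k) := by
  simp [SE]

/-- Colours for odd powers. -/
def SO (r k h : ℕ) : Finset (ℕ × ℕ) := insert (r - 1, h) (SE r k)

theorem SO_card (r k h : ℕ) : (SO r k h).card ≤ k * (r - 1) + 1 + 1 :=
  (Finset.card_insert_le _ _).trans (Nat.succ_le_succ (SE_card r k))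

theorem mem_SO {r k h c i : ℕ} : (c, i) ∈ SO r k h ↔ (c = r - 1 ∧ i = h) ∨ (c = 0 ∧ i = 0) ∨
    (c < r - 1 ∧ 1 ≤ i ∧ i ≤ k) := by
  simp [SO, mem_SE]

theorem exists_fresh2 {N a b : ℕ} (h : 3 ≤ N) : ∃ c < N, c ≠ a ∧ c ≠ b := by
  by_contra! hh
  have h0 := hh 0
  have h1 := hh 1
  have h2 := hh 2
  omega

theorem exists_fresh3 {N a b c : ℕ} (h : 4 ≤ N) : ∃ d < N, d ≠ a ∧ d ≠ b ∧ d ≠ c := by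
  by_contra! hh
  have h0 := hh 0
  have h1 := hh 1
  have h2 := hh 2
  have h3 := hh 3
  omega

theorem exists_fresh4 {N a b c d : ℕ} (h : 5 ≤ N) : ∃ e < N, e ≠ a ∧ e ≠ b ∧ e ≠ c ∧ e ≠ d := by
  by_contra! hh
  have h0 := hh 0
  have h1 := hh 1
  have h2 := hh 2
  have h3 := hh 3
  have h4 := hh 4
  omega

end Build

/-- Even powers, `r ≥ 5`. -/
theorem good_E5 (r k t : ℕ) (hr : 5 ≤ r) (ht : t ≤ 2 * k) :
    Good r (2 * k) (2 * k + 1 + t) := by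
  obtain ⟨s, s1, s2, s3⟩ := exists_labels r (by omega)
  refine ⟨SE r k, fun u v d => if d = 0 then (0, 0) else (s u v, d), ?_, ?_, ?_⟩
  · have := SE_card r k
    have e1 : 2 * k / 2 = k := by omega
    rw [e1]; omega
  · intros; simp
  intro u v huv hv
  have hu : u < r := by omega
  have A1 := s1 u v hu hv (by omega)
  have B1 := s1 v u hv hu (by omega)
  have AB := s3 u v hu hv (by omega)
  obtain ⟨C, hC, hC1, hC2⟩ := exists_fresh2 (N := r - 1) (a := s u v) (b := s v u) (by omega)
  obtain ⟨D, hD, hD1, hD2, hD3⟩ :=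
    exists_fresh3 (N := r - 1) (a := s u v) (b := s v u) (c := C) (by omega)
  have inj := s2 u v
  have inj' := s2 v u
  generalize hA : s u v = A at *
  generalize hB : s v u = B at *
  refine edge_build (k := k) (by omega) (by omega)
    (fun p => if p ≤ k + (t + 1) / 2 then (C, 2 * k + 1 - p) else (D, p - t)) ?_ ?_ ?_ ?_ ?_ ?_ ?_ ?_ ?_ ?_ ?_
  all_goals (intros; grind [mem_SE])

/-- Odd powers, `n = m + 1`. -/
theorem good_O0 (r k : ℕ) (hr : 4 ≤ r) (hk : 1 ≤ k) :
    Good r (2 * k + 1) (2 * k + 2) := by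
  obtain ⟨s, s1, s2, s3⟩ := exists_labels r (by omega)
  refine ⟨SO r k 1, fun u v d => if d = 0 then (0, 0) else (s u v, d), ?_, ?_, ?_⟩
  · have := SO_card r k 1
    have e1 : (2 * k + 1) / 2 = k := by omega
    rw [e1]; omega
  · intros; simp
  intro u v huv hv
  have hu : u < r := by omega
  have A1 := s1 u v hu hv (by omega)
  have B1 := s1 v u hv hu (by omega)
  have AB := s3 u v hu hv (by omega)
  have inj := s2 u v
  have inj' := s2 v u
  have bd := s1 u
  have bd' := s1 v
  generalize hA : s u v = A at *
  generalize hB : s v u = B at *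
  refine edge_build (k := k) (by omega) (by omega)
    (fun p => (r - 1, 1)) ?_ ?_ ?_ ?_ ?_ ?_ ?_ ?_ ?_ ?_ ?_
  all_goals (intros; grind [mem_SO])

/-- Asymmetric labels for `K_4` with orientations. -/
theorem data4_asym : ∃ (s : ℕ → ℕ → ℕ) (o : ℕ → ℕ → Bool),
    (∀ u v, u < 4 → v < 4 → u ≠ v → s u v < 3) ∧
    (∀ u v w, u < 4 → v < 4 → w < 4 → u ≠ v → u ≠ w → v ≠ w → s u v ≠ s u w) ∧
    (∀ u v, u < 4 → v < 4 → u ≠ v → s u v ≠ s v u) ∧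
    (∀ u v, u < 4 → v < 4 → u ≠ v → ∃ C < 3, C ≠ s u v ∧ C ≠ s v u ∧ o u C ≠ o v C) := by
  let s : ℕ → ℕ → ℕ := fun u v =>
    ([[0, 1, 0, 2], [2, 0, 1, 0], [1, 2, 0, 0], [0, 1, 2, 0]].getD u []).getD v 0
  let o : ℕ → ℕ → Bool := fun u c =>
    ([[false, false, true], [true, false, true], [false, false, false],
      [false, true, false]].getD u []).getD c false
  have h1 : ∀ u < 4, ∀ v < 4, u ≠ v → s u v < 3 := by decide
  have h2 : ∀ u v w : Fin 4, u.1 ≠ v.1 → u.1 ≠ w.1 → v.1 ≠ w.1 → s u.1 v.1 ≠ s u.1 w.1 := by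
    decide
  have h3 : ∀ u < 4, ∀ v < 4, u ≠ v → s u v ≠ s v u := by decide
  have h4 : ∀ u < 4, ∀ v < 4, u ≠ v → ∃ C < 3, C ≠ s u v ∧ C ≠ s v u ∧ o u C ≠ o v C := by decide
  exact ⟨s, o, fun u v hu hv => h1 u hu v hv, fun u v w hu hv hw => h2 ⟨u, hu⟩ ⟨v, hv⟩ ⟨w, hw⟩,
    fun u v hu hv => h3 u hu v hv, fun u v hu hv => h4 u hu v hv⟩

/-- Symmetric labels for `K_4` with orientations. -/
theorem data4_sym : ∃ (s : ℕ → ℕ → ℕ) (o : ℕ → ℕ → Bool),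
    (∀ u v, u < 4 → v < 4 → u ≠ v → s u v < 3) ∧
    (∀ u v w, u < 4 → v < 4 → w < 4 → u ≠ v → u ≠ w → v ≠ w → s u v ≠ s u w) ∧
    (∀ u v, u < 4 → v < 4 → u ≠ v → s u v = s v u ∧ o u (s u v) ≠ o v (s u v)) ∧
    (∀ u v, u < 4 → v < 4 → u ≠ v → ∃ B < 3, ∃ C < 3, B ≠ C ∧ B ≠ s u v ∧ C ≠ s u v ∧
      o u B = o v B ∧ o u C ≠ o v C) := by
  let s : ℕ → ℕ → ℕ := fun u v =>
    ([[0, 0, 1, 2], [0, 0, 2, 1], [1, 2, 0, 0], [2, 1, 0, 0]].getD u []).getD v 0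
  let o : ℕ → ℕ → Bool := fun u c =>
    ([[true, true, true], [false, false, true], [true, false, false],
      [false, true, false]].getD u []).getD c false
  have h1 : ∀ u < 4, ∀ v < 4, u ≠ v → s u v < 3 := by decide
  have h2 : ∀ u v w : Fin 4, u.1 ≠ v.1 → u.1 ≠ w.1 → v.1 ≠ w.1 → s u.1 v.1 ≠ s u.1 w.1 := by
    decide
  have h3 : ∀ u < 4, ∀ v < 4, u ≠ v → s u v = s v u ∧ o u (s u v) ≠ o v (s u v) := by decide
  have h4 : ∀ u v : Fin 4, u.1 ≠ v.1 → ∃ B C : Fin 3, B.1 ≠ C.1 ∧ B.1 ≠ s u.1 v.1 ∧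
      C.1 ≠ s u.1 v.1 ∧ o u.1 B.1 = o v.1 B.1 ∧ o u.1 C.1 ≠ o v.1 C.1 := by decide
  refine ⟨s, o, fun u v hu hv => h1 u hu v hv, fun u v w hu hv hw => h2 ⟨u, hu⟩ ⟨v, hv⟩ ⟨w, hw⟩,
    fun u v hu hv => h3 u hu v hv, fun u v hu hv huv => ?_⟩
  obtain ⟨B, C, h⟩ := h4 ⟨u, hu⟩ ⟨v, hv⟩ huv
  exact ⟨B.1, B.2, C.1, C.2, h⟩

/-- Even powers, `r = 4`, short edges. -/
theorem good_E4a (k t : ℕ) (ht : t ≤ k) : Good 4 (2 * k) (2 * k + 1 + t) := by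
  obtain ⟨s, o, s1, s2, s3, s4⟩ := data4_asym
  refine ⟨SE 4 k, fun u v d => if d = 0 then (0, 0) else (s u v, if o u (s u v) = true ∧ k < d + t then 2 * k + 1 - t - d else d), ?_, ?_, ?_⟩
  · have := SE_card 4 k
    have e1 : 2 * k / 2 = k := by omega
    rw [e1]; omega
  · intros; simp
  intro u v huv hv
  have hu : u < 4 := by omega
  have A1 := s1 u v hu hv (by omega)
  have B1 := s1 v u hv hu (by omega)
  have AB := s3 u v hu hv (by omega)
  obtain ⟨C, hC, hC1, hC2, hC3⟩ := s4 u v hu hv (by omega)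
  have inj := s2 u v
  have inj' := s2 v u
  generalize hA : s u v = A at *
  generalize hB : s v u = B at *
  clear s1 s2 s3 s4
  refine edge_build (k := k) (by omega) (by omega)
    (fun p => (C, if o u C = true ∧ p < k + 1 + t then p - t else 2 * k + 1 - p)) ?_ ?_ ?_ ?_ ?_ ?_ ?_ ?_ ?_ ?_ ?_
  all_goals (intros; grind [mem_SE])

/-- Even powers, `r = 4`, long edges. -/
theorem good_E4b (k t : ℕ) (ht : k < t) (ht' : t ≤ 2 * k) : Good 4 (2 * k) (2 * k + 1 + t) := by
  obtain ⟨s, o, s1, s2, s3, s4⟩ := data4_sym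
  refine ⟨SE 4 k, fun u v d => if d = 0 then (0, 0) else (s u v, if o u (s u v) = true then d else k + 1 - d), ?_, ?_, ?_⟩
  · have := SE_card 4 k
    have e1 : 2 * k / 2 = k := by omega
    rw [e1]; omega
  · intros; simp
  intro u v huv hv
  have hu : u < 4 := by omega
  have A1 := s1 u v hu hv (by omega)
  have B1 := s1 v u hv hu (by omega)
  obtain ⟨AB, hA3⟩ := s3 u v hu hv (by omega)
  obtain ⟨B, hB, C, hC, hBC, hB1, hC1, hB2, hC2⟩ := s4 u v hu hv (by omega)
  have inj := s2 u v
  have inj' := s2 v u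
  generalize hA : s u v = A at *
  generalize hB : s v u = A' at *
  clear s1 s2 s3 s4
  subst AB
  refine edge_build (k := k) (by omega) (by omega)
    (fun p => if p ≤ k + (t + 1) / 2 then (B, if o u B = true then 2 * k + 1 - p else p - k) else (C, if o v C = true then p - t else k + 1 - (p - t)))
    ?_ ?_ ?_ ?_ ?_ ?_ ?_ ?_ ?_ ?_ ?_
  all_goals (intros; grind [mem_SE])

set_option maxHeartbeats 4000000 in
/-- Odd powers, `r ≥ 5`, short edges. -/
theorem good_O5a (r k t h : ℕ) (hr : 5 ≤ r) (hk : 1 ≤ k) (ht : 1 ≤ t) (ht' : t ≤ k + 1)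
    (hh : h = if t ≤ k then k + 1 - t else 1) :
    Good r (2 * k + 1) (2 * k + 2 + t) := by
  obtain ⟨s, s1, s2, s3⟩ := exists_labels r (by omega)
  obtain ⟨f, f1, f2, f3⟩ := exists_derangements r (by omega)
  refine ⟨SO r k h, fun u v d => if d = 0 then (0, 0) else (if d = h then f u v else s u v, d),
    ?_, ?_, ?_⟩
  · have := SO_card r k h
    have e1 : (2 * k + 1) / 2 = k := by omega
    rw [e1]; omega
  · intros; simp
  intro u v huv hv
  have hu : u < r := by omega
  have A1 := s1 u v hu hv (by omega)
  have B1 := s1 v u hv hu (by omega)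
  have AB := s3 u v hu hv (by omega)
  obtain ⟨C, hC, hC1, hC2⟩ := exists_fresh2 (N := r - 1) (a := s u v) (b := s v u) (by omega)
  obtain ⟨D, hD, hD1, hD2, hD3⟩ :=
    exists_fresh3 (N := r - 1) (a := s u v) (b := s v u) (c := C) (by omega)
  obtain ⟨γ, g, g1, g2, g3, g4⟩ :=
    exists_fresh4 (N := r) (a := u) (b := v) (c := f u v) (d := f v u) (by omega)
  have F1 := f1 u v hu hv (by omega)
  have F2 := f1 v u hv hu (by omega)
  have F3 := f3 u v hu hv (by omega)
  have F4 := f2 u v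
  have F5 := f2 v u
  have F6 := f1 u
  have F7 := f1 v
  have inj := s2 u v
  have inj' := s2 v u
  clear s1 s2 s3 f1 f2 f3
  generalize hA : s u v = A at *
  generalize hB : s v u = B at *
  refine edge_build (k := k) (by omega) (by omega)
    (fun p => if p = k + 1 then (u, h) else if p = k + 1 + t then (v, h) else
      if p ≤ k + 1 + t / 2 then (if 2 * k + 2 - p = h then γ else C, 2 * k + 2 - p)
      else (if p - t = h then γ else D, p - t)) ?_ ?_ ?_ ?_ ?_ ?_ ?_ ?_ ?_ ?_ ?_
  all_goals (intros; grind (splits := 20) [mem_SO])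

set_option maxHeartbeats 4000000 in
/-- Odd powers, `r ≥ 5`, long edges. -/
theorem good_O5b (r k t : ℕ) (hr : 5 ≤ r) (hk : 1 ≤ k) (ht : k + 2 ≤ t) (ht' : t ≤ 2 * k + 1) :
    Good r (2 * k + 1) (2 * k + 2 + t) := by
  obtain ⟨s, s1, s2, s3⟩ := exists_labels r (by omega)
  refine ⟨SO r k 1, fun u v d => if d = 0 then (0, 0) else (if d = 1 then v else s u v, d),
    ?_, ?_, ?_⟩
  · have := SO_card r k 1
    have e1 : (2 * k + 1) / 2 = k := by omega
    rw [e1]; omega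
  · intros; simp
  intro u v huv hv
  have hu : u < r := by omega
  have A1 := s1 u v hu hv (by omega)
  have B1 := s1 v u hv hu (by omega)
  have AB := s3 u v hu hv (by omega)
  obtain ⟨C, hC, hC1, hC2⟩ := exists_fresh2 (N := r - 1) (a := s u v) (b := s v u) (by omega)
  obtain ⟨D, hD, hD1, hD2, hD3⟩ :=
    exists_fresh3 (N := r - 1) (a := s u v) (b := s v u) (c := C) (by omega)
  obtain ⟨γ, g, g1, g2⟩ := exists_fresh2 (N := r) (a := u) (b := v) (by omega)
  obtain ⟨δ, g', g1', g2', g3'⟩ := exists_fresh3 (N := r) (a := u) (b := v) (c := γ) (by omega)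
  have inj := s2 u v
  have inj' := s2 v u
  clear s1 s2 s3
  generalize hA : s u v = A at *
  generalize hB : s v u = B at *
  refine edge_build (k := k) (by omega) (by omega)
    (fun p => if p = k + 1 then (u, 1) else if p = k + 1 + t then (v, 1) else
      if p ≤ k + 1 + t / 2 then (if 2 * k + 2 - p = 1 then γ else C, 2 * k + 2 - p)
      else (if p - t = 1 then δ else D, p - t)) ?_ ?_ ?_ ?_ ?_ ?_ ?_ ?_ ?_ ?_ ?_
  all_goals (intros; grind (splits := 20) [mem_SO])

set_option maxHeartbeats 4000000 in
/-- Odd powers, `r = 4`, short edges. -/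
theorem good_O4a (k t h : ℕ) (ht : 1 ≤ t) (ht' : t ≤ k) (hh : h = k + 1 - t) :
    Good 4 (2 * k + 1) (2 * k + 2 + t) := by
  obtain ⟨s, o, s1, s2, s3, s4⟩ := data4_asym
  obtain ⟨f, f1, f2, f3⟩ := exists_derangements 4 (by omega)
  refine ⟨SO 4 k h, fun u v d => if d = 0 then (0, 0) else if d = h then (f u v, d) else
    (s u v, if o u (s u v) = true ∧ h < d then k + h + 1 - d else d), ?_, ?_, ?_⟩
  · have := SO_card 4 k h
    have e1 : (2 * k + 1) / 2 = k := by omega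
    rw [e1]; omega
  · intros; simp
  intro u v huv hv
  have hu : u < 4 := by omega
  have A1 := s1 u v hu hv (by omega)
  have B1 := s1 v u hv hu (by omega)
  have AB := s3 u v hu hv (by omega)
  obtain ⟨C, hC, hC1, hC2, hC3⟩ := s4 u v hu hv (by omega)
  have F1 := f1 u v hu hv (by omega)
  have F2 := f1 v u hv hu (by omega)
  have F3 := f3 u v hu hv (by omega)
  have F4 := f2 u v
  have F5 := f2 v u
  have F6 := f1 u
  have F7 := f1 v
  have inj := s2 u v
  have inj' := s2 v u
  clear s1 s2 s3 s4 f1 f2 f3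
  generalize hA : s u v = A at *
  generalize hB : s v u = B at *
  refine edge_build (k := k) (by omega) (by omega)
    (fun p => if p = k + 1 then (u, h) else if p = k + 1 + t then (v, h) else
      (C, if o u C = true ∧ h < 2 * k + 2 - p then k + h + 1 - (2 * k + 2 - p) else 2 * k + 2 - p))
    ?_ ?_ ?_ ?_ ?_ ?_ ?_ ?_ ?_ ?_ ?_
  all_goals (intros; grind (splits := 20) [mem_SO])

set_option maxHeartbeats 4000000 in
/-- Odd powers, `r = 4`, middle length. -/
theorem good_O4b (k h : ℕ) (hk : 3 ≤ k) (hh : h = (k + 1) / 2) :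
    Good 4 (2 * k + 1) (3 * k + 3) := by
  obtain ⟨s, o, s1, s2, s3, s4⟩ := data4_sym
  obtain ⟨f, f1, f2, f3⟩ := exists_derangements 4 (by omega)
  refine ⟨SO 4 k h, fun u v d => if d = 0 then (0, 0) else
    if (if o u (s u v) = true then d else k + 1 - d) = h then (f u v, h) else
    (s u v, if o u (s u v) = true then d else k + 1 - d), ?_, ?_, ?_⟩
  · have := SO_card 4 k h
    have e1 : (2 * k + 1) / 2 = k := by omega
    rw [e1]; omega
  · intros; simp
  intro u v huv hv
  have hu : u < 4 := by omega
  have A1 := s1 u v hu hv (by omega)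
  have B1 := s1 v u hv hu (by omega)
  obtain ⟨AB, hA3⟩ := s3 u v hu hv (by omega)
  obtain ⟨B, hB, C, hC, hBC, hB1, hC1, hB2, hC2⟩ := s4 u v hu hv (by omega)
  have F1 := f1 u v hu hv (by omega)
  have F2 := f1 v u hv hu (by omega)
  have F3 := f3 u v hu hv (by omega)
  have F4 := f2 u v
  have F5 := f2 v u
  have F6 := f1 u
  have F7 := f1 v
  have inj := s2 u v
  have inj' := s2 v u
  clear s1 s2 s3 s4 f1 f2 f3
  generalize hA : s u v = A at *
  generalize hA' : s v u = A' at *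
  subst AB
  refine edge_build (k := k) (by omega) (by omega)
    (fun p => if p = k + 1 then (u, h) else if p = 2 * k + 2 then (v, h) else
      if (if o u C = true then 2 * k + 2 - p else k + 1 - (2 * k + 2 - p)) = h then
        (B, if o u B = true then k else 1)
      else (C, if o u C = true then 2 * k + 2 - p else k + 1 - (2 * k + 2 - p)))
    ?_ ?_ ?_ ?_ ?_ ?_ ?_ ?_ ?_ ?_ ?_
  all_goals (intros; grind (splits := 20) [mem_SO])

set_option maxHeartbeats 4000000 in
/-- Odd powers, `r = 4`, long edges. -/
theorem good_O4c (k t : ℕ) (hk : 1 ≤ k) (ht : k + 2 ≤ t) (ht' : t ≤ 2 * k + 1) :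
    Good 4 (2 * k + 1) (2 * k + 2 + t) := by
  obtain ⟨s, o, s1, s2, s3, s4⟩ := data4_sym
  refine ⟨SO 4 k 1, fun u v d => if d = 0 then (0, 0) else if d = 1 then (v, 1) else
    (s u v, if o u (s u v) = true then d else k + 2 - d), ?_, ?_, ?_⟩
  · have := SO_card 4 k 1
    have e1 : (2 * k + 1) / 2 = k := by omega
    rw [e1]; omega
  · intros; simp
  intro u v huv hv
  have hu : u < 4 := by omega
  have A1 := s1 u v hu hv (by omega)
  have B1 := s1 v u hv hu (by omega)
  obtain ⟨AB, hA3⟩ := s3 u v hu hv (by omega)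
  obtain ⟨B, hB, C, hC, hBC, hB1, hC1, hB2, hC2⟩ := s4 u v hu hv (by omega)
  obtain ⟨γ, g, g1, g2⟩ := exists_fresh2 (N := 4) (a := u) (b := v) (by omega)
  obtain ⟨δ, g', g1', g2', g3'⟩ := exists_fresh3 (N := 4) (a := u) (b := v) (c := γ) (by omega)
  have inj := s2 u v
  have inj' := s2 v u
  clear s1 s2 s3 s4
  generalize hA : s u v = A at *
  generalize hA' : s v u = A' at *
  subst AB
  refine edge_build (k := k) (by omega) (by omega)
    (fun p => if p = k + 1 then (u, 1) else if p = k + 1 + t then (v, 1) else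
      if p ≤ k + 1 + t / 2 then
        (if 2 * k + 2 - p = 1 then (γ, 1) else
          (B, if o u B = true then 2 * k + 2 - p else k + 2 - (2 * k + 2 - p)))
      else (if p - t = 1 then (δ, 1) else
          (C, if o v C = true then p - t else k + 2 - (p - t))))
    ?_ ?_ ?_ ?_ ?_ ?_ ?_ ?_ ?_ ?_ ?_
  all_goals (intros; grind (splits := 20) [mem_SO])

/-- Colour of position `p` on the edge `uv`, read off a table. -/
def tab (n : ℕ) (L : List (List (List ℕ))) (u v p : ℕ) : ℕ :=
  if u < v then ((L.getD u []).getD v []).getD p 0 else ((L.getD v []).getD u []).getD (n - p) 0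

theorem good_of_table (m n N : ℕ) (L : List (List (List ℕ))) (B : ℕ → ℕ) (hmn : m < n)
    (hN : N ≤ (m / 2) * 3 + 1 + m % 2)
    (h1 : ∀ u v : Fin 4, u < v → ∀ p : Fin (n + 1), tab n L u v p < N)
    (h2 : ∀ u v : Fin 4, u < v → tab n L u v 0 = B u ∧ tab n L u v n = B v)
    (h3 : ∀ u v : Fin 4, u < v → ∀ p q : Fin (n + 1), p < q → q.1 ≤ p.1 + m →
      tab n L u v p ≠ tab n L u v q)
    (h4 : ∀ u v w : Fin 4, u ≠ v → w ≠ u → w ≠ v → ∀ j p : Fin (m + 1), 1 ≤ j.1 → 1 ≤ p.1 →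
      j.1 + p.1 ≤ m → tab n L u v p ≠ tab n L u w j) :
    Good 4 m n := by
  have rev : ∀ u v p, u < v → p ≤ n → tab n L v u p = tab n L u v (n - p) := by
    intro u v p huv hp
    simp only [tab]
    rw [if_neg (by omega), if_pos huv]
  refine ⟨Finset.range N ×ˢ {0}, fun u v d => if d = 0 then (B u, 0) else (tab n L u v d, 0),
    ?_, ?_, ?_⟩
  · simpa using hN
  · intros; simp
  intro u v huv hv
  have hu : u < 4 := by omega
  have huv' : (⟨u, hu⟩ : Fin 4) < ⟨v, hv⟩ := huv
  have hne : (⟨u, hu⟩ : Fin 4) ≠ ⟨v, hv⟩ := huv'.ne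
  have k2 := h2 _ _ huv'
  refine ⟨fun p => (tab n L u v p, 0), ?_, ?_, ?_, ?_, ?_, ?_⟩
  · intro p hp
    have := h1 _ _ huv' ⟨p, by omega⟩
    simpa using this
  · intro p hp
    by_cases h : p = 0
    · subst h; simpa using k2.1
    · simp [h]
  · intro p hp
    by_cases h : p = 0
    · subst h; simpa using k2.2
    · simp only [h, if_false]; rw [rev u v p huv (by omega)]
  · intro p q hpq hq hqm h
    exact h3 _ _ huv' ⟨p, by omega⟩ ⟨q, by omega⟩ hpq hqm (congrArg Prod.fst h)
  · intro w hw hwu hwv j p hj hj' hp hjp h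
    beta_reduce at h
    rw [if_neg (by omega)] at h
    exact h4 ⟨u, hu⟩ ⟨v, hv⟩ ⟨w, hw⟩ hne (by simpa using hwu) (by simpa using hwv)
      ⟨j, by omega⟩ ⟨p, by omega⟩ hj hp hjp (congrArg Prod.fst h)
  · intro w hw hwu hwv j p hj hj' hp hjp h
    beta_reduce at h
    rw [if_neg (by omega)] at h
    have h5 : tab n L v u p ≠ tab n L v w j :=
      h4 ⟨v, hv⟩ ⟨u, hu⟩ ⟨w, hw⟩ hne.symm (by simpa using hwv) (by simpa using hwu)
      ⟨j, by omega⟩ ⟨p, by omega⟩ hj hp hjp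
    rw [rev u v p huv (by omega)] at h5
    exact h5 (congrArg Prod.fst h)

theorem good_4_3_6 : Good 4 3 6 := by
  refine good_of_table 3 6 5 [[[], [0, 1, 4, 2, 0, 3, 1], [0, 2, 4, 1, 3, 0, 4], [0, 3, 4, 2, 1, 0, 3]],
    [[], [], [1, 4, 0, 2, 3, 1, 4], [1, 2, 0, 4, 1, 2, 3]],
    [[], [], [], [4, 2, 3, 0, 1, 4, 3]],
    [[], [], [], []]]
    (fun u => [0, 1, 4, 3].getD u 0) (by decide) (by decide) ?_ ?_ ?_ ?_ <;> decide +kernel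

theorem good_4_5_9 : Good 4 5 9 := by
  refine good_of_table 5 9 8 [[[], [0, 1, 2, 7, 4, 5, 3, 1, 6, 2], [0, 3, 4, 7, 6, 2, 5, 1, 0, 7], [0, 5, 6, 7, 2, 1, 0, 4, 5, 3]],
    [[], [], [2, 4, 0, 3, 1, 6, 5, 2, 4, 7], [2, 7, 5, 3, 1, 4, 0, 2, 7, 3]],
    [[], [], [], [7, 3, 6, 5, 2, 4, 0, 1, 6, 3]],
    [[], [], [], []]]
    (fun u => [0, 2, 7, 3].getD u 0) (by decide) (by decide) ?_ ?_ ?_ ?_ <;> decide +kernel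



theorem good_base (r m n : ℕ) (hr : 4 ≤ r) (hm : 1 < m) (hmn : m < n) (hn : n ≤ 2 * m + 1) :
    Good r m n := by
  obtain ⟨t, rfl⟩ : ∃ t, n = m + 1 + t := ⟨n - (m + 1), by omega⟩
  obtain ⟨k, hk⟩ : ∃ k, k = m / 2 := ⟨_, rfl⟩
  rcases Nat.mod_two_eq_zero_or_one m with h0 | h0
  · obtain rfl : m = 2 * k := by omega
    by_cases h5 : 5 ≤ r
    · exact good_E5 r k t h5 (by omega)
    obtain rfl : r = 4 := by omega
    by_cases ht : t ≤ k
    · exact good_E4a k t ht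
    · exact good_E4b k t (by omega) (by omega)
  · obtain rfl : m = 2 * k + 1 := by omega
    rcases Nat.eq_zero_or_pos t with rfl | ht
    · exact good_O0 r k hr (by omega)
    by_cases h5 : 5 ≤ r
    · by_cases h6 : t ≤ k + 1
      · exact good_O5a r k t _ h5 (by omega) ht h6 rfl
      · exact good_O5b r k t h5 (by omega) (by omega) (by omega)
    obtain rfl : r = 4 := by omega
    by_cases h6 : t ≤ k
    · exact good_O4a k t _ ht h6 rfl
    by_cases h7 : t = k + 1
    · subst h7
      by_cases h8 : k = 1
      · subst h8; exact good_4_3_6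
      by_cases h9 : k = 2
      · subst h9; exact good_4_5_9
      have := good_O4b k _ (by omega) rfl
      have e : 2 * k + 1 + 1 + (k + 1) = 3 * k + 3 := by omega
      rw [e]; exact this
    · exact good_O4c k t (by omega) (by omega) (by omega)

theorem good_all (r m : ℕ) (hr : 4 ≤ r) (hm : 1 < m) : ∀ n, m < n → Good r m n := by
  intro n
  induction n using Nat.strong_induction_on with
  | _ n ih =>
    intro hmn
    by_cases h : n ≤ 2 * m + 1
    · exact good_base r m n hr hm hmn h
    · have := (ih (n - (m + 1)) (by omega) (by omega)).ext (by omega)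
      have e : n - (m + 1) + (m + 1) = n := by omega
      rwa [e] at this

theorem complete_graph_chromatic_eq_clique (r : ℕ) (hr : 4 ≤ r)
    (m n : ℕ) (h1m : 1 < m) (hmn : m < n) :
    (fracPower (⊤ : SimpleGraph (Fin r)) m n).chromaticNumber =
      (fracPower (⊤ : SimpleGraph (Fin r)) m n).cliqueNum := by
  exact main_of_good (by omega) h1m hmn (good_all r m hr h1m n hmn)
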